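/- Let k ≥ 2 and m ≥ (432k)² be integers, and let G* be a graph attaining the maximum spectral radius among all minimally (k,k)-edge-connected graphs with m edges. If G* has exactly k−2 vertices of degree 1, then the number of vertices of G* satisfies (m+k)/2 + 1 ≤ |V(G*)| ≤ (m+k)/2 + √m − 1. -/

import Mathlib

open SimpleGraph

/-- The `l`-edge-connectivity of a graph: the minimum number of edges whose removal
leaves a graph with at least `l` connected components, if the graph has at least `l`
vertices; otherwise the number of vertices. -/
noncomputable def edgeConnL {V : Type*} (l : ℕ) (G : SimpleGraph V) : ℕ :=
  if l ≤ Nat.card V then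
    sInf {c : ℕ | ∃ F : Set (Sym2 V), F ⊆ G.edgeSet ∧ F.ncard = c ∧
      l ≤ Nat.card (G.deleteEdges F).ConnectedComponent}
  else Nat.card V

/-- A graph is minimally `(k,l)`-edge-connected if it is connected, its
`l`-edge-connectivity is at least `k`, and deleting any edge drops the
`l`-edge-connectivity below `k`. -/
def IsMinimallyKLEdgeConnected {V : Type*} (k l : ℕ) (G : SimpleGraph V) : Prop :=
  G.Connected ∧ k ≤ edgeConnL l G ∧
    ∀ e ∈ G.edgeSet, edgeConnL l (G.deleteEdges {e}) < k

/-- The real adjacency matrix of a simple graph. -/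
noncomputable def adjMat {V : Type*} (G : SimpleGraph V) : Matrix V V ℝ :=
  letI := Classical.decRel G.Adj
  G.adjMatrix ℝ

/-- The spectral radius of a graph: the largest (real) eigenvalue of its adjacency matrix. -/
noncomputable def specRad {V : Type*} [Fintype V] [DecidableEq V]
    (G : SimpleGraph V) : ℝ :=
  sSup (spectrum ℝ (adjMat G))

/-- A graph is 2-connected if it has at least three vertices, is connected, and removing any
single vertex leaves a connected graph. -/
def TwoConnected {V : Type*} (G : SimpleGraph V) : Prop :=
  3 ≤ Nat.card V ∧ G.Connected ∧ ∀ v : V, (G.induce {w | w ≠ v}).Connected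

/-- `B` induces a block of `G`: a maximal 2-connected (induced) subgraph of `G`,
with respect to vertices. -/
def IsBlock {V : Type*} (G : SimpleGraph V) (B : Set V) : Prop :=
  TwoConnected (G.induce B) ∧ ∀ B' : Set V, B ⊆ B' → TwoConnected (G.induce B') → B' = B

/-- The degree of a vertex, as the cardinality of its neighbourhood. -/
noncomputable def ncDegree {V : Type*} (G : SimpleGraph V) (v : V) : ℕ :=
  {w | G.Adj v w}.ncard

section Spectral

open Classical in
lemma adjMat_apply {V : Type*} (G : SimpleGraph V) (i j : V) :
    adjMat G i j = if G.Adj i j then 1 else 0 := by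
  simp [adjMat, SimpleGraph.adjMatrix_apply]

lemma adjMat_isHermitian {V : Type*} (G : SimpleGraph V) : (adjMat G).IsHermitian := by
  ext i j
  classical
  rw [Matrix.conjTranspose_apply, adjMat_apply, adjMat_apply, star_trivial]
  exact if_congr (G.adj_comm j i) rfl rfl

open Classical in
lemma adjMat_mulVec_apply {V : Type*} [Fintype V] (G : SimpleGraph V) (x : V → ℝ) (i : V) :
    (adjMat G).mulVec x i = ∑ j with G.Adj i j, x j := by
  simp [Matrix.mulVec, dotProduct, adjMat_apply, Finset.sum_filter]

lemma specRad_mem_spectrum {V : Type*} [Fintype V] [DecidableEq V] [Nonempty V]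
    (G : SimpleGraph V) : specRad G ∈ spectrum ℝ (adjMat G) := by
  have h := (adjMat_isHermitian G).spectrum_real_eq_range_eigenvalues
  refine Set.Nonempty.csSup_mem ?_ ?_
  · rw [h]; exact Set.range_nonempty _
  · exact (adjMat G).finite_real_spectrum

lemma rayleigh_le_specRad {V : Type*} [Fintype V] [DecidableEq V]
    (G : SimpleGraph V) (y : V → ℝ) :
    y ⬝ᵥ (adjMat G).mulVec y ≤ specRad G * (y ⬝ᵥ y) := by
  have hA := adjMat_isHermitian G
  have hB : (specRad G • (1 : Matrix V V ℝ) - adjMat G).PosSemidef := by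
    rw [Matrix.posSemidef_iff_isHermitian_and_spectrum_nonneg]
    refine ⟨?_, ?_⟩
    · exact (Matrix.isHermitian_one.smul (IsSelfAdjoint.all _)).sub hA
    · intro a ha
      rw [← Algebra.algebraMap_eq_smul_one, ← spectrum.singleton_sub_eq] at ha
      obtain ⟨b, hb, c, hc, rfl⟩ := Set.mem_sub.1 ha
      rw [Set.mem_singleton_iff.1 hb]
      have : c ≤ specRad G := le_csSup (adjMat G).finite_real_spectrum.bddAbove hc
      simpa using this
  have := hB.dotProduct_mulVec_nonneg y
  simp only [Matrix.sub_mulVec, Matrix.smul_mulVec, Matrix.one_mulVec, star_trivial,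
    dotProduct_sub, dotProduct_smul, smul_eq_mul] at this
  linarith

open Classical in
/-- Taking absolute values in an eigenvector gives a normalized subinvariant vector. -/
lemma exists_subinvariant {V : Type*} [Fintype V] [DecidableEq V] [Nonempty V]
    (G : SimpleGraph V) : ∃ (x : V → ℝ) (u : V), (∀ i, 0 ≤ x i) ∧ (∀ i, x i ≤ 1) ∧ x u = 1 ∧
      ∀ i, specRad G * x i ≤ ∑ j with G.Adj i j, x j := by
  have h := specRad_mem_spectrum G
  rw [← Matrix.spectrum_toLin', ← Module.End.hasEigenvalue_iff_mem_spectrum] at h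
  obtain ⟨y, hy⟩ := h.exists_hasEigenvector
  obtain ⟨hy1, hy0⟩ := Module.End.hasEigenvector_iff.1 hy
  rw [Module.End.mem_eigenspace_iff, Matrix.toLin'_apply] at hy1
  obtain ⟨u, -, hu⟩ := Finset.exists_max_image Finset.univ (fun i => |y i|) Finset.univ_nonempty
  have hpos : 0 < |y u| := by
    obtain ⟨i, hi⟩ := Function.ne_iff.1 hy0
    exact (abs_pos.2 hi).trans_le (hu i (Finset.mem_univ _))
  refine ⟨fun i => |y i| / |y u|, u, fun i => by positivity, fun i => ?_, div_self hpos.ne', ?_⟩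
  · exact (div_le_one hpos).2 (hu i (Finset.mem_univ _))
  · intro i
    rw [← Finset.sum_div, ← mul_div_assoc]
    refine div_le_div_of_nonneg_right ?_ hpos.le
    have := congrFun hy1 i
    rw [adjMat_mulVec_apply, Pi.smul_apply, smul_eq_mul] at this
    calc specRad G * |y i| ≤ |specRad G| * |y i| := by gcongr; exact le_abs_self _
      _ = |∑ j with G.Adj i j, y j| := by rw [this, abs_mul]
      _ ≤ _ := Finset.abs_sum_le_sum_abs _ _

end Spectral

section EdgeConnectivity

variable {V : Type*}

lemma reachable_deleteEdges_or {G : SimpleGraph V} {a b x y : V} (h : G.Reachable x y) :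
    (G.deleteEdges {s(a, b)}).Reachable x y ∨
      (((G.deleteEdges {s(a, b)}).Reachable x a ∨ (G.deleteEdges {s(a, b)}).Reachable x b) ∧
        ((G.deleteEdges {s(a, b)}).Reachable y a ∨ (G.deleteEdges {s(a, b)}).Reachable y b)) := by
  obtain ⟨p⟩ := h
  induction p with
  | nil => exact Or.inl .rfl
  | @cons x z y hxz p ih =>
    by_cases he : s(x, z) = s(a, b)
    · right
      rcases Sym2.eq_iff.1 he with ⟨rfl, rfl⟩ | ⟨rfl, rfl⟩
      · exact ⟨Or.inl .rfl, ih.elim (fun h => Or.inr h.symm) fun h => h.2⟩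
      · exact ⟨Or.inr .rfl, ih.elim (fun h => Or.inl h.symm) fun h => h.2⟩
    · have hxz' : (G.deleteEdges {s(a, b)}).Reachable x z :=
        SimpleGraph.Adj.reachable (by simpa [SimpleGraph.deleteEdges_adj, he] using hxz)
      exact ih.imp hxz'.trans fun h => ⟨h.1.imp hxz'.trans hxz'.trans, h.2⟩

lemma card_connectedComponent_deleteEdges_singleton_le [Finite V] (G : SimpleGraph V)
    (e : Sym2 V) : Nat.card (G.deleteEdges {e}).ConnectedComponent ≤
      Nat.card G.ConnectedComponent + 1 := by
  classical
  induction e with | _ a b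
  have := Fintype.ofFinite V
  rw [← Finite.card_option]
  let G' := G.deleteEdges {s(a, b)}
  let f : G'.ConnectedComponent → Option G.ConnectedComponent := fun c =>
    if c = G'.connectedComponentMk b then none
    else some (c.map (SimpleGraph.Hom.ofLE (G.deleteEdges_le _)))
  refine Nat.card_le_card_of_injective f fun c c' h => ?_
  by_cases hc : c = G'.connectedComponentMk b <;> by_cases hc' : c' = G'.connectedComponentMk b
  · rw [hc, hc']
  · simp [f, hc, hc'] at h
  · simp [f, hc, hc'] at h
  · simp only [f, hc, hc', if_false, Option.some.injEq] at h
    induction c using SimpleGraph.ConnectedComponent.ind with | _ x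
    induction c' using SimpleGraph.ConnectedComponent.ind with | _ y
    have h' : G.Reachable x y := by simpa using h
    rw [SimpleGraph.ConnectedComponent.eq] at hc hc' ⊢
    rcases reachable_deleteEdges_or (a := a) (b := b) h' with h | ⟨h1, h2⟩
    · exact h
    · exact (h1.resolve_right hc).trans (h2.resolve_right hc').symm

lemma card_connectedComponent_deleteEdges_le [Finite V] (G : SimpleGraph V)
    (F : Set (Sym2 V)) : Nat.card (G.deleteEdges F).ConnectedComponent ≤
      Nat.card G.ConnectedComponent + F.ncard := by
  induction F, F.toFinite using Set.Finite.induction_on generalizing G with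
  | empty => simp
  | @insert e F he hF ih =>
    rw [Set.ncard_insert_of_notMem he hF, Set.insert_eq, ← SimpleGraph.deleteEdges_deleteEdges]
    have := ih (G.deleteEdges {e})
    have := card_connectedComponent_deleteEdges_singleton_le G e
    omega

lemma card_connectedComponent_eq_one {G : SimpleGraph V} (hG : G.Connected) :
    Nat.card G.ConnectedComponent = 1 := by
  have := hG.nonempty
  have := hG.preconnected.subsingleton_connectedComponent
  exact Nat.card_unique

/-- If deleting fewer than `k` edges from a connected graph leaves `k` components, then all of
these edges are bridges. -/
lemma not_connected_deleteEdges_of_le_card [Finite V] {G : SimpleGraph V} {k : ℕ}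
    {F : Set (Sym2 V)} (hF : F.ncard < k)
    (hk : k ≤ Nat.card (G.deleteEdges F).ConnectedComponent) {f : Sym2 V} (hf : f ∈ F) :
    ¬ (G.deleteEdges {f}).Connected := by
  intro h
  have h1 := card_connectedComponent_deleteEdges_le (G.deleteEdges {f}) (F \ {f})
  rw [SimpleGraph.deleteEdges_deleteEdges, Set.union_sdiff_cancel (Set.singleton_subset_iff.2 hf),
    card_connectedComponent_eq_one h] at h1
  have := Set.ncard_sdiff_singleton_add_one hf
  omega

lemma ncard_le_card_connectedComponent [Finite V] {G : SimpleGraph V} {S : Set V}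
    (hS : S.Pairwise fun a b => ¬ G.Reachable a b) :
    S.ncard ≤ Nat.card G.ConnectedComponent := by
  rw [← Nat.card_coe_set_eq]
  refine Nat.card_le_card_of_injective (fun s : S => G.connectedComponentMk s) fun s t h => ?_
  by_contra hst
  exact hS s.2 t.2 (fun h => hst (Subtype.ext h)) (SimpleGraph.ConnectedComponent.eq.1 h)

lemma le_edgeConnL_iff [Finite V] {G : SimpleGraph V} {k l : ℕ} (hl : l ≤ Nat.card V) :
    k ≤ edgeConnL l G ↔ ∀ F ⊆ G.edgeSet,
      l ≤ Nat.card (G.deleteEdges F).ConnectedComponent → k ≤ F.ncard := by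
  rw [edgeConnL, if_pos hl]
  constructor
  · intro h F hF hc
    exact h.trans (Nat.sInf_le ⟨F, hF, rfl, hc⟩)
  · intro h
    refine le_csInf ⟨_, G.edgeSet, subset_rfl, rfl, ?_⟩ ?_
    · refine hl.trans ?_
      rw [← Set.ncard_univ]
      refine ncard_le_card_connectedComponent fun a _ b _ hab => ?_
      simpa using hab
    · rintro c ⟨F, hF, rfl, hc⟩
      exact h F hF hc

lemma edgeConnL_lt_iff [Finite V] {G : SimpleGraph V} {k l : ℕ} (hl : l ≤ Nat.card V) :
    edgeConnL l G < k ↔ ∃ F ⊆ G.edgeSet,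
      l ≤ Nat.card (G.deleteEdges F).ConnectedComponent ∧ F.ncard < k := by
  rw [← not_le, le_edgeConnL_iff hl]
  push Not
  rfl

lemma le_card_of_le_edgeConnL [Finite V] {G : SimpleGraph V} {k : ℕ}
    (h : k ≤ edgeConnL k G) : k ≤ Nat.card V := by
  by_contra hk
  rw [edgeConnL, if_neg hk] at h
  exact hk h

end EdgeConnectivity

section Structure

variable {V : Type*}

/-- The edges having an endpoint of degree one. -/
def pendantEdges (G : SimpleGraph V) : Set (Sym2 V) :=
  {e ∈ G.edgeSet | ∃ v ∈ e, ncDegree G v = 1}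

/-- The edges of `G` leaving `S` are exactly `e` and `f`. -/
def IsPairCut (G : SimpleGraph V) (e f : Sym2 V) (S : Set V) : Prop :=
  ∀ x y, G.Adj x y → ((x ∈ S ↔ y ∈ S) ↔ s(x, y) ≠ e ∧ s(x, y) ≠ f)

lemma forall_of_reachable {G : SimpleGraph V} {P : V → Prop} {a b : V} (h : G.Reachable a b)
    (hP : ∀ x y, G.Adj x y → P x → P y) (ha : P a) : P b := by
  obtain ⟨p⟩ := h
  induction p with
  | nil => exact ha
  | cons hxz p ih => exact ih (hP _ _ hxz ha)

lemma not_reachable_of_isolated {G : SimpleGraph V} {a b : V} (h : ∀ y, ¬ G.Adj a y)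
    (hab : a ≠ b) : ¬ G.Reachable a b := by
  intro hr
  refine hab (forall_of_reachable (P := fun x => a = x) hr ?_ rfl)
  rintro x y hxy rfl
  exact (h y hxy).elim

lemma exists_adj_iff_of_ncDegree_eq_one {G : SimpleGraph V} {a : V} (h : ncDegree G a = 1) :
    ∃ b, ∀ y, G.Adj a y ↔ y = b := by
  obtain ⟨b, hb⟩ := Set.ncard_eq_one.1 h
  exact ⟨b, fun y => Set.ext_iff.1 hb y⟩

lemma not_adj_of_ncDegree_eq_one {G : SimpleGraph V} (hG : G.Connected)
    (hE : 2 ≤ G.edgeSet.ncard) {a b : V} (ha : ncDegree G a = 1) (hb : ncDegree G b = 1) :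
    ¬ G.Adj a b := by
  intro hab
  obtain ⟨a', ha'⟩ := exists_adj_iff_of_ncDegree_eq_one ha
  obtain ⟨b', hb'⟩ := exists_adj_iff_of_ncDegree_eq_one hb
  obtain rfl := (ha' b).1 hab
  obtain rfl := (hb' a).1 hab.symm
  have hall : ∀ x, x = a ∨ x = b := fun x => by
    refine forall_of_reachable (P := fun x => x = a ∨ x = b) (hG.preconnected a x) ?_ (Or.inl rfl)
    rintro x y hxy (rfl | rfl)
    · exact Or.inr ((ha' y).1 hxy)
    · exact Or.inl ((hb' y).1 hxy)
  have hsub : G.edgeSet ⊆ {s(a, b)} := by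
    intro e he
    induction e with | _ x y
    have hxy : G.Adj x y := he
    rcases hall x with rfl | rfl <;> rcases hall y with rfl | rfl <;> simp_all
  have := Set.ncard_le_ncard hsub
  rw [Set.ncard_singleton] at this
  omega

lemma ncard_pendantEdges [Finite V] {G : SimpleGraph V} (hG : G.Connected)
    (hE : 2 ≤ G.edgeSet.ncard) :
    (pendantEdges G).ncard = {v : V | ncDegree G v = 1}.ncard := by
  have := hG.nonempty
  have hnb : ∀ a, ∃ b, ncDegree G a = 1 → ∀ y, G.Adj a y ↔ y = b := fun a => by
    by_cases ha : ncDegree G a = 1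
    · obtain ⟨b, hb⟩ := exists_adj_iff_of_ncDegree_eq_one ha
      exact ⟨b, fun _ => hb⟩
    · exact ⟨a, fun h => (ha h).elim⟩
  choose nb hnb using hnb
  symm
  refine Set.ncard_congr (fun v _ => s(v, nb v)) ?_ ?_ ?_
  · intro v hv
    exact ⟨(hnb v hv _).2 rfl, v, Sym2.mem_mk_left _ _, hv⟩
  · intro v w hv hw h
    rcases Sym2.eq_iff.1 h with ⟨h, -⟩ | ⟨h, -⟩
    · exact h
    · refine (not_adj_of_ncDegree_eq_one hG hE hw hv ?_).elim
      rw [h]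
      exact (hnb w hw _).2 rfl
  · rintro e ⟨he, v, hv, hd⟩
    obtain ⟨w, rfl⟩ := Sym2.mem_iff_exists.1 hv
    exact ⟨v, hd, by rw [(hnb v hd w).1 he]⟩

lemma connected_deleteEdges_of_notMem_pendantEdges [Finite V] {G : SimpleGraph V} {k : ℕ}
    (hk : 2 ≤ k) (hG : IsMinimallyKLEdgeConnected k k G) (hE : 2 ≤ G.edgeSet.ncard)
    (hpendant : {v : V | ncDegree G v = 1}.ncard = k - 2) {e : Sym2 V} (he : e ∈ G.edgeSet)
    (hep : e ∉ pendantEdges G) : (G.deleteEdges {e}).Connected := by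
  obtain ⟨hconn, hcon, -⟩ := hG
  by_contra hbr
  induction e with | _ a b
  have hab : ¬ (G.deleteEdges {s(a, b)}).Reachable a b := by
    rw [← SimpleGraph.isBridge_iff]
    by_contra h
    exact hbr (hconn.connected_delete_edge_of_not_isBridge h)
  have hda : ncDegree G a ≠ 1 := fun h => hep ⟨he, a, by simp, h⟩
  have hdb : ncDegree G b ≠ 1 := fun h => hep ⟨he, b, by simp, h⟩
  have hne : a ≠ b := SimpleGraph.Adj.ne he
  set D := {v : V | ncDegree G v = 1} with hD
  set F := insert s(a, b) (pendantEdges G) with hFdef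
  have hF : F.ncard < k := by
    have := Set.ncard_insert_le s(a, b) (pendantEdges G)
    rw [ncard_pendantEdges hconn hE, hpendant, ← hFdef] at this
    omega
  have hiso : ∀ x ∈ D, ∀ y, ¬ (G.deleteEdges F).Adj x y := by
    intro x hx y hxy
    rw [SimpleGraph.deleteEdges_adj] at hxy
    exact hxy.2 (Or.inr ⟨hxy.1, x, by simp, hx⟩)
  have hS : (insert a (insert b D)).Pairwise fun x y => ¬ (G.deleteEdges F).Reachable x y := by
    have hab' : ¬ (G.deleteEdges F).Reachable a b := fun h =>
      hab (h.mono (SimpleGraph.deleteEdges_anti (by simp [hFdef])))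
    intro x hx y hy hxy hr
    rcases hx with rfl | rfl | hx
    · rcases hy with rfl | rfl | hy
      · exact hxy rfl
      · exact hab' hr
      · exact not_reachable_of_isolated (hiso y hy) hxy.symm hr.symm
    · rcases hy with rfl | rfl | hy
      · exact hab' hr.symm
      · exact hxy rfl
      · exact not_reachable_of_isolated (hiso y hy) hxy.symm hr.symm
    · exact not_reachable_of_isolated (hiso x hx) hxy hr
  have h1 := ncard_le_card_connectedComponent hS
  rw [Set.ncard_insert_of_notMem (by simp [hne, hD, hda]),
    Set.ncard_insert_of_notMem (by simp [hD, hdb]), hpendant] at h1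
  have := (le_edgeConnL_iff (le_card_of_le_edgeConnL hcon)).1 hcon F
    (Set.insert_subset he fun e he => he.1) (by omega)
  omega

lemma exists_isPairCut [Finite V] {G : SimpleGraph V} {k : ℕ}
    (hk : 2 ≤ k) (hG : IsMinimallyKLEdgeConnected k k G) (hE : 2 ≤ G.edgeSet.ncard)
    (hpendant : {v : V | ncDegree G v = 1}.ncard = k - 2) {e : Sym2 V} (he : e ∈ G.edgeSet)
    (hep : e ∉ pendantEdges G) :
    ∃ f ∈ G.edgeSet, f ∉ pendantEdges G ∧ f ≠ e ∧ ∃ S, IsPairCut G e f S := by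
  have hB := fun {e} => connected_deleteEdges_of_notMem_pendantEdges (e := e) hk hG hE hpendant
  have hGe := hB he hep
  obtain ⟨hconn, hcon, hmin⟩ := hG
  have hV := le_card_of_le_edgeConnL hcon
  obtain ⟨F, hFE, hFc, hFk⟩ := (edgeConnL_lt_iff hV).1 (hmin e he)
  have heF : e ∉ F := fun h => by simpa using hFE h
  have hFG : F ⊆ G.edgeSet := fun f hf => by
    have := hFE hf
    rw [SimpleGraph.edgeSet_deleteEdges] at this
    exact this.1
  have hcard : k ≤ F.ncard + 1 := by
    rw [← Set.ncard_insert_of_notMem heF]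
    refine (le_edgeConnL_iff hV).1 hcon _ (Set.insert_subset he hFG) ?_
    rwa [Set.insert_eq, ← SimpleGraph.deleteEdges_deleteEdges]
  obtain ⟨f, hf, hfp⟩ : ∃ f ∈ F, f ∉ pendantEdges G := by
    by_contra! h
    have := Set.ncard_le_ncard (show F ⊆ pendantEdges G from h)
    rw [ncard_pendantEdges hconn hE, hpendant] at this
    omega
  have hnc := not_connected_deleteEdges_of_le_card hFk hFc hf
  have hGf := hB (hFG hf) hfp
  refine ⟨f, hFG hf, hfp, fun h => heF (h ▸ hf), ?_⟩
  induction f with | _ c d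
  have hcd : ¬ ((G.deleteEdges {e}).deleteEdges {s(c, d)}).Reachable c d := by
    rw [← SimpleGraph.isBridge_iff]
    by_contra h
    exact hnc (hGe.connected_delete_edge_of_not_isBridge h)
  set H := (G.deleteEdges {e}).deleteEdges {s(c, d)} with hH
  have hadj : ∀ x y, G.Adj x y → s(x, y) ≠ e → s(x, y) ≠ s(c, d) → H.Adj x y := by
    intro x y hxy h1 h2
    rw [hH, SimpleGraph.deleteEdges_adj, SimpleGraph.deleteEdges_adj]
    exact ⟨⟨hxy, h1⟩, h2⟩
  have hsame : ∀ x y, G.Adj x y → s(x, y) ≠ e → s(x, y) ≠ s(c, d) →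
      (H.Reachable c x ↔ H.Reachable c y) := fun x y hxy h1 h2 =>
    ⟨fun h => h.trans (hadj x y hxy h1 h2).reachable,
      fun h => h.trans (hadj x y hxy h1 h2).symm.reachable⟩
  refine ⟨{x | H.Reachable c x}, fun x y hxy => ⟨fun h => ⟨?_, ?_⟩, fun h => ?_⟩⟩
  · rintro rfl
    refine hcd (forall_of_reachable (P := fun z => H.Reachable c z)
      (hGf.preconnected c d) ?_ .rfl)
    intro p q hpq hp
    rw [SimpleGraph.deleteEdges_adj] at hpq
    by_cases hpe : s(p, q) = s(x, y)
    · rcases Sym2.eq_iff.1 hpe with ⟨rfl, rfl⟩ | ⟨rfl, rfl⟩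
      · exact h.1 hp
      · exact h.2 hp
    · exact (hsame p q hpq.1 hpe hpq.2).1 hp
  · intro h2
    rcases Sym2.eq_iff.1 h2 with ⟨rfl, rfl⟩ | ⟨rfl, rfl⟩
    · exact hcd (h.1 .rfl)
    · exact hcd (h.2 .rfl)
  · exact hsame x y hxy h.1 h.2

end Structure

section Tree

variable {V : Type*}

lemma IsPairCut.mem_iff_of_three_common {G : SimpleGraph V} {e f : Sym2 V} {S : Set V}
    (hS : IsPairCut G e f S) {u v : V} (h3 : 3 ≤ {w | G.Adj u w ∧ G.Adj v w}.ncard) :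
    u ∈ S ↔ v ∈ S := by
  obtain ⟨w₁, ⟨hu₁, hv₁⟩, w₂, ⟨hu₂, hv₂⟩, w₃, ⟨hu₃, hv₃⟩, h₁₂, h₁₃, h₂₃⟩ :=
    (Set.two_lt_ncard (Set.finite_of_ncard_ne_zero (by omega))).1 h3
  by_contra huv
  have key : ∀ w, G.Adj u w → G.Adj v w →
      ∃ g, (g = e ∨ g = f) ∧ (g = s(u, w) ∨ g = s(v, w)) := by
    intro w huw hvw
    by_contra! h
    have h1 := (hS u w huw).2 ⟨fun h' => (h e (Or.inl rfl)).1 h'.symm,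
      fun h' => (h f (Or.inr rfl)).1 h'.symm⟩
    have h2 := (hS v w hvw).2 ⟨fun h' => (h e (Or.inl rfl)).2 h'.symm,
      fun h' => (h f (Or.inr rfl)).2 h'.symm⟩
    exact huv (h1.trans h2.symm)
  have hcross : ∀ w w', G.Adj u w → G.Adj v w → w ≠ w' →
      ∀ g g', (g = s(u, w) ∨ g = s(v, w)) → (g' = s(u, w') ∨ g' = s(v, w')) → g ≠ g' := by
    rintro w w' h1 h2 hne g g' hg hg' rfl
    have hwg : w ∈ g := by rcases hg with rfl | rfl <;> simp
    rcases hg' with rfl | rfl <;> rcases Sym2.mem_iff.1 hwg with rfl | h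
    exacts [h1.ne rfl, hne h, h2.ne rfl, hne h]
  obtain ⟨g₁, he₁, hg₁⟩ := key w₁ hu₁ hv₁
  obtain ⟨g₂, he₂, hg₂⟩ := key w₂ hu₂ hv₂
  obtain ⟨g₃, he₃, hg₃⟩ := key w₃ hu₃ hv₃
  have c12 := hcross w₁ w₂ hu₁ hv₁ h₁₂ _ _ hg₁ hg₂
  have c13 := hcross w₁ w₃ hu₁ hv₁ h₁₃ _ _ hg₁ hg₃
  have c23 := hcross w₂ w₃ hu₂ hv₂ h₂₃ _ _ hg₂ hg₃
  rcases he₁ with rfl | rfl <;> rcases he₂ with rfl | rfl <;> rcases he₃ with rfl | rfl <;>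
    first | exact c12 rfl | exact c13 rfl | exact c23 rfl

lemma pendantEdges_subset_edgeSet_of_connected {G T : SimpleGraph V} (hT : T ≤ G)
    (hTc : T.Connected) : pendantEdges G ⊆ T.edgeSet := by
  rintro e ⟨he, v, hv, hd⟩
  obtain ⟨w, rfl⟩ := Sym2.mem_iff_exists.1 hv
  obtain ⟨w', hw'⟩ := exists_adj_iff_of_ncDegree_eq_one hd
  obtain rfl := (hw' w).1 he
  have hne : v ≠ w := SimpleGraph.Adj.ne he
  by_contra hvw
  refine not_reachable_of_isolated (G := T) (fun y hy => hvw ?_) hne (hTc.preconnected v w)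
  rw [← (hw' y).1 (hT hy)]
  exact hy

lemma iff_iff_iff_swap {p q r t : Prop} (h : (p ↔ q) ↔ (r ↔ t)) : (p ↔ r) ↔ (q ↔ t) := by
  tauto

/-- Two-edge cuts match the edges outside a suitable spanning tree injectively with tree edges,
missing the pendant edges and two further ones. -/
lemma ncard_edgeSet_add_le [Finite V] {G : SimpleGraph V} (hG : G.Connected)
    (hcut : ∀ e ∈ G.edgeSet, e ∉ pendantEdges G →
      ∃ f ∈ G.edgeSet, f ∉ pendantEdges G ∧ f ≠ e ∧ ∃ S, IsPairCut G e f S)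
    {u v : V} (huv : u ≠ v) (h3 : 3 ≤ {w | G.Adj u w ∧ G.Adj v w}.ncard) :
    G.edgeSet.ncard + (pendantEdges G).ncard + 4 ≤ 2 * Nat.card V := by
  classical
  obtain ⟨w, huw, hvw⟩ : {w | G.Adj u w ∧ G.Adj v w}.Nonempty :=
    Set.nonempty_of_ncard_ne_zero (by omega)
  have hdeg : ∀ x a b : V, a ≠ b → G.Adj x a → G.Adj x b → ncDegree G x ≠ 1 := by
    intro x a b hab ha hb h
    obtain ⟨y, hy⟩ := exists_adj_iff_of_ncDegree_eq_one h
    exact hab (((hy a).1 ha).trans ((hy b).1 hb).symm)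
  have hw1 : ncDegree G w ≠ 1 := hdeg w u v huv huw.symm hvw.symm
  have huv1 : ncDegree G u ≠ 1 ∧ ncDegree G v ≠ 1 := by
    obtain ⟨a, ha, b, hb, hab⟩ := (Set.one_lt_ncard (Set.toFinite _)).1
      (show 1 < {w | G.Adj u w ∧ G.Adj v w}.ncard by omega)
    exact ⟨hdeg u a b hab ha.1 hb.1, hdeg v a b hab ha.2 hb.2⟩
  have hacy : (((⊥ : SimpleGraph V) ⊔ SimpleGraph.edge u w) ⊔ SimpleGraph.edge v w).IsAcyclic := by
    refine SimpleGraph.IsAcyclic.sup_edge_of_not_reachable ?_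
      (SimpleGraph.IsAcyclic.sup_edge_of_not_reachable ?_ SimpleGraph.isAcyclic_bot)
    · refine not_reachable_of_isolated (fun y => ?_) hvw.ne
      simp [SimpleGraph.edge_adj, huv.symm, hvw.ne]
    · simpa using huw.ne
  obtain ⟨T, hHT, hTG, hT⟩ := hG.exists_isTree_le_of_le_of_isAcyclic (H :=
    ((⊥ : SimpleGraph V) ⊔ SimpleGraph.edge u w) ⊔ SimpleGraph.edge v w) (by
      simp only [bot_sup_eq, sup_le_iff]
      exact ⟨(SimpleGraph.edge_le_iff _).2 (Or.inr huw), (SimpleGraph.edge_le_iff _).2 (Or.inr hvw)⟩)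
    hacy
  have hTuw : T.Adj u w := hHT (by simp [SimpleGraph.edge_adj, huw.ne])
  have hTvw : T.Adj v w := hHT (by simp [SimpleGraph.edge_adj, hvw.ne])
  have hTcard : T.edgeSet.ncard + 1 = Nat.card V := by
    rw [← Nat.card_coe_set_eq]
    exact (SimpleGraph.isTree_iff_connected_and_card.1 hT).2
  have hPT := pendantEdges_subset_edgeSet_of_connected hTG hT.connected
  choose! f hfG hfP hfe S hS using hcut
  set X := insert s(u, w) (insert s(v, w) (pendantEdges G)) with hX
  have hXcard : X.ncard = (pendantEdges G).ncard + 2 := by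
    rw [hX, Set.ncard_insert_of_notMem, Set.ncard_insert_of_notMem]
    · rintro ⟨-, x, hx, hd⟩
      rcases Sym2.mem_iff.1 hx with rfl | rfl
      exacts [huv1.2 hd, hw1 hd]
    · rintro (h | ⟨-, x, hx, hd⟩)
      · rw [Sym2.eq_iff] at h
        have := huw.ne
        tauto
      · rcases Sym2.mem_iff.1 hx with rfl | rfl
        exacts [huv1.1 hd, hw1 hd]
  have hXT : X ⊆ T.edgeSet := Set.insert_subset hTuw (Set.insert_subset hTvw hPT)
  have hmaps : ∀ e ∈ G.edgeSet \ T.edgeSet, f e ∈ T.edgeSet \ X := by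
    rintro e ⟨heG, heT⟩
    have heP : e ∉ pendantEdges G := fun h => heT (hPT h)
    have hSe := hS e heG heP
    have hsame := hSe.mem_iff_of_three_common h3
    refine ⟨?_, ?_⟩
    · by_contra hfT
      induction e with | _ a b
      have hab : G.Adj a b := heG
      have hiff : a ∈ S s(a, b) ↔ b ∈ S s(a, b) := by
        refine forall_of_reachable (P := fun z => a ∈ S s(a, b) ↔ z ∈ S s(a, b))
          (hT.connected.preconnected a b) ?_ Iff.rfl
        intro x y hxy h
        refine h.trans ((hSe x y (hTG hxy)).2 ⟨?_, ?_⟩)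
        · rintro h; exact heT (h ▸ hxy)
        · rintro h; exact hfT (h ▸ hxy)
      exact ((hSe a b hab).1 hiff).1 rfl
    · rintro (h | h | h)
      · have h1 := hSe u w huw
        have h2 := hSe v w hvw
        rw [h] at h1 h2
        have h3 : s(v, w) ≠ e := by rintro rfl; exact heT hTvw
        have h4 : s(v, w) ≠ s(u, w) := by simp [huv.symm, hvw.ne]
        exact (h1.1 (hsame.trans (h2.2 ⟨h3, h4⟩))).2 rfl
      · have h1 := hSe v w hvw
        have h2 := hSe u w huw
        rw [h] at h1 h2
        have h3 : s(u, w) ≠ e := by rintro rfl; exact heT hTuw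
        have h4 : s(u, w) ≠ s(v, w) := by simp [huv, huw.ne]
        exact (h1.1 (hsame.symm.trans (h2.2 ⟨h3, h4⟩))).2 rfl
      · exact hfP e heG heP h
  have hinj : Set.InjOn f (G.edgeSet \ T.edgeSet) := by
    rintro e₁ ⟨heG₁, heT₁⟩ e₂ ⟨heG₂, heT₂⟩ hf
    have hS₁ := hS e₁ heG₁ fun h => heT₁ (hPT h)
    have hS₂ := hS e₂ heG₂ fun h => heT₂ (hPT h)
    have hf1 := hfe e₁ heG₁ fun h => heT₁ (hPT h)
    rw [← hf] at hS₂
    by_contra hne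
    induction e₁ with | _ a b
    have hab : G.Adj a b := heG₁
    have hiff : (a ∈ S s(a, b) ↔ a ∈ S e₂) ↔ (b ∈ S s(a, b) ↔ b ∈ S e₂) := by
      refine forall_of_reachable
        (P := fun z => (a ∈ S s(a, b) ↔ a ∈ S e₂) ↔ (z ∈ S s(a, b) ↔ z ∈ S e₂))
        (hT.connected.preconnected a b) ?_ Iff.rfl
      intro x y hxy h
      have h1 := hS₁ x y (hTG hxy)
      have h2 := hS₂ x y (hTG hxy)
      have h3 : s(x, y) ≠ s(a, b) := by rintro h; exact heT₁ (h ▸ hxy)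
      have h4 : s(x, y) ≠ e₂ := by rintro h; exact heT₂ (h ▸ hxy)
      have h5 : (x ∈ S s(a, b) ↔ y ∈ S s(a, b)) ↔ (x ∈ S e₂ ↔ y ∈ S e₂) := by
        rw [h1, h2]
        simp only [h3, h4, ne_eq, not_false_eq_true, true_and]
      exact h.trans (iff_iff_iff_swap h5)
    have h1 := hS₁ a b hab
    have h2 := (hS₂ a b hab).2 ⟨hne, hf1.symm⟩
    have h3 : a ∈ S s(a, b) ↔ b ∈ S s(a, b) := by
      exact (iff_iff_iff_swap hiff).2 h2
    exact (h1.1 h3).1 rfl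
  have hle := Set.ncard_le_ncard_of_injOn f hmaps hinj
  rw [Set.ncard_sdiff hXT, hXcard,
    Set.ncard_sdiff (SimpleGraph.edgeSet_subset_edgeSet.2 hTG)] at hle
  have := Set.ncard_le_ncard hXT
  omega

end Tree

section LocalStructure

variable {V : Type*} {G : SimpleGraph V}

lemma notMem_pendantEdges {a b c d : V} (hac : G.Adj a c) (hcb : c ≠ b) (hbd : G.Adj b d)
    (hda : d ≠ a) (hab : G.Adj a b) : s(a, b) ∉ pendantEdges G := by
  rintro ⟨-, x, hx, hd⟩
  obtain ⟨y, hy⟩ := exists_adj_iff_of_ncDegree_eq_one hd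
  rcases Sym2.mem_iff.1 hx with rfl | rfl
  · exact hcb (((hy c).1 hac).trans ((hy b).1 hab).symm)
  · exact hda (((hy d).1 hbd).trans ((hy a).1 hab.symm).symm)

lemma IsPairCut.eq_or_eq_of_triangle {a b c : V} {f : Sym2 V} {S : Set V}
    (hS : IsPairCut G s(a, b) f S) (hab : G.Adj a b) (hac : G.Adj a c) (hbc : G.Adj b c) :
    f = s(a, c) ∨ f = s(b, c) := by
  by_contra! h
  have h1 := (hS a c hac).2 ⟨by simp [hbc.ne', hab.ne], h.1.symm⟩
  have h2 := (hS b c hbc).2 ⟨by simp [hac.ne', hab.ne'], h.2.symm⟩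
  exact ((hS a b hab).1 (h1.trans h2.symm)).1 rfl

/-- Every edge lies in at most one triangle. -/
lemma eq_of_common_triangle_edge
    (hcut : ∀ e ∈ G.edgeSet, e ∉ pendantEdges G →
      ∃ f ∈ G.edgeSet, f ∉ pendantEdges G ∧ f ≠ e ∧ ∃ S, IsPairCut G e f S)
    {a b c d : V} (hab : G.Adj a b) (hac : G.Adj a c)
    (hbc : G.Adj b c) (had : G.Adj a d) (hbd : G.Adj b d) : c = d := by
  obtain ⟨f, -, -, -, S, hS⟩ := hcut s(a, b) hab
    (notMem_pendantEdges hac hbc.ne' hbc hac.ne' hab)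
  have h1 := hS.eq_or_eq_of_triangle hab hac hbc
  have h2 := hS.eq_or_eq_of_triangle hab had hbd
  by_contra hcd
  have hcf : c ∈ f := by rcases h1 with rfl | rfl <;> simp
  rcases h2 with rfl | rfl <;> rcases Sym2.mem_iff.1 hcf with rfl | rfl
  exacts [hac.ne rfl, hcd rfl, hbc.ne rfl, hcd rfl]

/-- A triangle and a four-cycle through a common vertex share no edge there. -/
lemma eq_of_triangle_of_four_cycle
    (hcut : ∀ e ∈ G.edgeSet, e ∉ pendantEdges G →
      ∃ f ∈ G.edgeSet, f ∉ pendantEdges G ∧ f ≠ e ∧ ∃ S, IsPairCut G e f S)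
    {u w z₁ z₂ z₃ : V} (hwu : w ≠ u) (huw : ¬ G.Adj u w)
    (h₁ : G.Adj u z₁) (h₂ : G.Adj u z₂) (h₃ : G.Adj u z₃) (h₁₃ : G.Adj z₁ z₃)
    (hw₁ : G.Adj z₁ w) (hw₂ : G.Adj z₂ w) : z₁ = z₂ := by
  by_contra hne
  obtain rfl | hne' := eq_or_ne z₂ z₃
  · exact hwu (eq_of_common_triangle_edge hcut h₁₃ hw₁ hw₂ h₁.symm h₂.symm)
  obtain ⟨f, -, -, -, S, hS⟩ := hcut s(u, z₁) h₁
    (notMem_pendantEdges h₃ h₁₃.ne' h₁₃ h₃.ne' h₁)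
  have hz₃ : z₃ ∈ f := by
    rcases hS.eq_or_eq_of_triangle h₁ h₃ h₁₃ with rfl | rfl <;> simp
  have hw₃ : z₃ ≠ w := by rintro rfl; exact huw h₃
  have hS1 := (hS z₁ w hw₁).2 ⟨by simp [h₁.ne', hwu], by
    rintro rfl; rcases Sym2.mem_iff.1 hz₃ with h | h
    exacts [h₁₃.ne h.symm, hw₃ h]⟩
  have hS2 := (hS z₂ w hw₂).2 ⟨by simp [h₂.ne', Ne.symm hne], by
    rintro rfl; rcases Sym2.mem_iff.1 hz₃ with h | h
    exacts [hne' h.symm, hw₃ h]⟩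
  have hS3 := (hS u z₂ h₂).2 ⟨by simp [h₁.ne, Ne.symm hne], by
    rintro rfl; rcases Sym2.mem_iff.1 hz₃ with h | h
    exacts [h₃.ne h.symm, hne' h.symm]⟩
  exact ((hS u z₁ h₁).1 (hS3.trans (hS2.trans hS1.symm))).1 rfl

end LocalStructure

section Counting

open Finset Classical

lemma adjMat_comm {V : Type*} {G : SimpleGraph V} (z w : V) : adjMat G z w = adjMat G w z := by
  rw [adjMat_apply, adjMat_apply]
  exact if_congr (G.adj_comm z w) rfl rfl

lemma adjMat_nonneg {V : Type*} {G : SimpleGraph V} (z w : V) : 0 ≤ adjMat G z w := by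
  rw [adjMat_apply]; split_ifs <;> norm_num

/-- The number of neighbours of `z` in `A`. -/
noncomputable def degIn {V : Type*} (G : SimpleGraph V) (A : Finset V) (z : V) : ℝ :=
  ∑ w ∈ A, adjMat G z w

lemma degIn_nonneg {V : Type*} {G : SimpleGraph V} (A : Finset V) (z : V) : 0 ≤ degIn G A z :=
  sum_nonneg fun _ _ => adjMat_nonneg _ _

lemma degIn_eq_card {V : Type*} {G : SimpleGraph V} (A : Finset V) (z : V) :
    degIn G A z = #{w ∈ A | G.Adj z w} := by
  simp [degIn, adjMat_apply]

lemma sum_degIn_mul_comm {V : Type*} {G : SimpleGraph V} (A B : Finset V) (x : V → ℝ) :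
    ∑ z ∈ A, ∑ w ∈ B, adjMat G z w * x w = ∑ w ∈ B, degIn G A w * x w := by
  rw [sum_comm]
  refine sum_congr rfl fun w _ => ?_
  rw [degIn, sum_mul]
  exact sum_congr rfl fun z _ => by rw [adjMat_comm]

lemma sum_degIn_comm {V : Type*} {G : SimpleGraph V} (A B : Finset V) :
    ∑ z ∈ A, degIn G B z = ∑ w ∈ B, degIn G A w := by
  have := sum_degIn_mul_comm (G := G) A B 1
  simpa [degIn] using this

variable {V : Type*} [Fintype V]

/-- The neighbours of `u`. -/
noncomputable def nbrs (G : SimpleGraph V) (u : V) : Finset V := {z | G.Adj u z}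

/-- The vertices at distance at least two from `u`. -/
noncomputable def far (G : SimpleGraph V) (u : V) : Finset V := {z | z ≠ u ∧ ¬ G.Adj u z}

variable {G : SimpleGraph V} {u : V}

lemma mem_nbrs {z : V} : z ∈ nbrs G u ↔ G.Adj u z := by simp [nbrs]

lemma mem_far {z : V} : z ∈ far G u ↔ z ≠ u ∧ ¬ G.Adj u z := by simp [far]

lemma sum_eq_add_nbrs_add_far (G : SimpleGraph V) (u : V) (g : V → ℝ) :
    ∑ z, g z = g u + ∑ z ∈ nbrs G u, g z + ∑ z ∈ far G u, g z := by
  have h : (univ : Finset V) = insert u (nbrs G u ∪ far G u) := by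
    ext z
    by_cases h1 : z = u <;> by_cases h2 : G.Adj u z <;> simp [mem_nbrs, mem_far, h1, h2]
  rw [h, sum_insert, sum_union]
  · ring
  · rw [Finset.disjoint_left]
    intro z h1 h2
    exact (mem_far.1 h2).2 (mem_nbrs.1 h1)
  · simp [mem_nbrs, mem_far]

lemma sum_adjMat_mul_of_mem_nbrs {z : V} (hz : z ∈ nbrs G u) (x : V → ℝ) :
    ∑ w, adjMat G z w * x w = x u + ∑ w ∈ nbrs G u, adjMat G z w * x w +
      ∑ w ∈ far G u, adjMat G z w * x w := by
  rw [sum_eq_add_nbrs_add_far G u, adjMat_apply, if_pos (mem_nbrs.1 hz).symm, one_mul]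

lemma ncDegree_eq_sum (z : V) : (ncDegree G z : ℝ) = ∑ w, adjMat G z w := by
  simp only [adjMat_apply, sum_boole, ncDegree, Set.ncard_eq_toFinset_card']
  congr 2
  ext; simp

lemma ncDegree_of_mem_nbrs {z : V} (hz : z ∈ nbrs G u) :
    (ncDegree G z : ℝ) = 1 + degIn G (nbrs G u) z + degIn G (far G u) z := by
  rw [ncDegree_eq_sum]
  simpa [degIn] using sum_adjMat_mul_of_mem_nbrs hz 1

lemma ncDegree_of_mem_far {z : V} (hz : z ∈ far G u) :
    (ncDegree G z : ℝ) = degIn G (nbrs G u) z + degIn G (far G u) z := by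
  rw [ncDegree_eq_sum, sum_eq_add_nbrs_add_far G u, adjMat_apply,
    if_neg fun h => (mem_far.1 hz).2 h.symm, zero_add]
  rfl

lemma ncDegree_self : (ncDegree G u : ℝ) = #(nbrs G u) := by
  rw [ncDegree_eq_sum]; simp [adjMat_apply, nbrs]

lemma sum_ncDegree (G : SimpleGraph V) : ∑ z, (ncDegree G z : ℝ) = 2 * G.edgeSet.ncard := by
  have h := G.sum_degrees_eq_twice_card_edges
  have h1 : ∀ z, ncDegree G z = G.degree z := fun z => by
    rw [ncDegree, Set.ncard_eq_toFinset_card', ← SimpleGraph.card_neighborFinset_eq_degree]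
    congr 1
  have h2 : G.edgeSet.ncard = #G.edgeFinset := by
    rw [Set.ncard_eq_toFinset_card']; rfl
  simp only [h1, h2]
  exact_mod_cast h

/-- Counting edges by their position relative to `u` and its neighbourhood. -/
lemma two_mul_ncard_edgeSet (G : SimpleGraph V) (u : V) :
    2 * (G.edgeSet.ncard : ℝ) = 2 * #(nbrs G u) + ∑ z ∈ nbrs G u, degIn G (nbrs G u) z +
      2 * ∑ z ∈ far G u, degIn G (nbrs G u) z + ∑ z ∈ far G u, degIn G (far G u) z := by
  rw [← sum_ncDegree, sum_eq_add_nbrs_add_far G u, ncDegree_self,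
    sum_congr rfl fun z hz => ncDegree_of_mem_nbrs hz,
    sum_congr rfl fun z hz => ncDegree_of_mem_far hz]
  simp only [sum_add_distrib, sum_const, nsmul_eq_mul, mul_one]
  rw [sum_degIn_comm (nbrs G u) (far G u)]
  ring

lemma card_eq_one_add (G : SimpleGraph V) (u : V) :
    (Fintype.card V : ℝ) = 1 + #(nbrs G u) + #(far G u) := by
  have := sum_eq_add_nbrs_add_far G u 1
  simpa using this

variable {x : V → ℝ} {ρ : ℝ}

lemma sq_le_of_subinvariant (hρ : 0 ≤ ρ) (hxu : x u = 1)
    (hsub : ∀ i, ρ * x i ≤ ∑ j, adjMat G i j * x j) :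
    ρ ^ 2 ≤ #(nbrs G u) + ∑ z ∈ nbrs G u, degIn G (nbrs G u) z * x z +
      ∑ z ∈ far G u, degIn G (nbrs G u) z * x z := by
  have h1 : ρ ≤ ∑ z ∈ nbrs G u, x z := by
    have := hsub u
    rw [hxu, mul_one] at this
    refine this.trans_eq ?_
    simp [adjMat_apply, nbrs, sum_filter]
  calc ρ ^ 2 = ρ * ρ := sq ρ
    _ ≤ ρ * ∑ z ∈ nbrs G u, x z := by gcongr
    _ = ∑ z ∈ nbrs G u, ρ * x z := mul_sum _ _ _
    _ ≤ ∑ z ∈ nbrs G u, (1 + ∑ w ∈ nbrs G u, adjMat G z w * x w +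
      ∑ w ∈ far G u, adjMat G z w * x w) := sum_le_sum fun z hz => by
        rw [← hxu, ← sum_adjMat_mul_of_mem_nbrs hz]; exact hsub z
    _ = _ := by
        simp only [sum_add_distrib, sum_const, nsmul_eq_mul, mul_one, sum_degIn_mul_comm]

/-- The weight on triangles through `u` is small. -/
lemma sq_mul_sum_degIn_nbrs_le (hcut : ∀ e ∈ G.edgeSet, e ∉ pendantEdges G →
      ∃ f ∈ G.edgeSet, f ∉ pendantEdges G ∧ f ≠ e ∧ ∃ S, IsPairCut G e f S)
    (hρ : 0 ≤ ρ) (hx0 : ∀ i, 0 ≤ x i) (hx1 : ∀ i, x i ≤ 1)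
    (hsub : ∀ i, ρ * x i ≤ ∑ j, adjMat G i j * x j) :
    ρ ^ 2 * ∑ z ∈ nbrs G u, degIn G (nbrs G u) z * x z ≤
      2 * ρ * ∑ z ∈ nbrs G u, degIn G (nbrs G u) z +
        ∑ z ∈ far G u, (degIn G (nbrs G u) z + degIn G (far G u) z) := by
  have hc1 : ∀ z ∈ nbrs G u, degIn G (nbrs G u) z ≤ 1 := by
    intro z hz
    rw [degIn_eq_card]
    norm_cast
    rw [card_le_one]
    intro a ha b hb
    simp only [mem_filter, mem_nbrs] at ha hb hz
    exact eq_of_common_triangle_edge hcut hz ha.1 ha.2 hb.1 hb.2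
  have hinner : ∀ z ∈ nbrs G u, ∑ w ∈ nbrs G u, adjMat G z w * x w ≤ 1 := fun z hz =>
    (sum_le_sum fun w _ => mul_le_of_le_one_right (adjMat_nonneg z w) (hx1 w)).trans (hc1 z hz)
  have hfar : ∀ w ∈ far G u, ∑ z ∈ nbrs G u, degIn G (nbrs G u) z * adjMat G z w ≤ 1 := by
    intro w hw
    calc ∑ z ∈ nbrs G u, degIn G (nbrs G u) z * adjMat G z w
        ≤ ∑ z ∈ nbrs G u, if (∃ z', G.Adj u z' ∧ G.Adj z z') ∧ G.Adj z w then (1 : ℝ) else 0 := by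
          refine sum_le_sum fun z hz => ?_
          by_cases h1 : ∃ z', G.Adj u z' ∧ G.Adj z z'
          · by_cases h2 : G.Adj z w
            · simpa [h1, h2, adjMat_apply] using hc1 z hz
            · simp [h2, adjMat_apply]
          · have : degIn G (nbrs G u) z = 0 := by
              rw [degIn_eq_card]
              norm_cast
              rw [card_eq_zero, filter_eq_empty_iff]
              exact fun z' hz' h => h1 ⟨z', mem_nbrs.1 hz', h⟩
            simp [h1, this]
      _ ≤ 1 := by
          rw [sum_boole]
          norm_cast
          rw [card_le_one]
          intro a ha b hb
          simp only [mem_filter, mem_nbrs] at ha hb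
          obtain ⟨ha, ⟨a', hua', haa'⟩, haw⟩ := ha
          obtain ⟨hb, -, hbw⟩ := hb
          obtain ⟨hwu, huw⟩ := mem_far.1 hw
          exact eq_of_triangle_of_four_cycle hcut hwu huw ha hb hua' haa' haw hbw
  have hstep : ρ * ∑ z ∈ nbrs G u, degIn G (nbrs G u) z * x z ≤
      2 * ∑ z ∈ nbrs G u, degIn G (nbrs G u) z + ∑ w ∈ far G u, x w := by
    calc ρ * ∑ z ∈ nbrs G u, degIn G (nbrs G u) z * x z
        = ∑ z ∈ nbrs G u, degIn G (nbrs G u) z * (ρ * x z) := by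
          rw [mul_sum]; exact sum_congr rfl fun z _ => by ring
      _ ≤ ∑ z ∈ nbrs G u, degIn G (nbrs G u) z *
          (2 + ∑ w ∈ far G u, adjMat G z w * x w) := by
          refine sum_le_sum fun z hz => mul_le_mul_of_nonneg_left ?_ (degIn_nonneg _ _)
          have h1 := hsub z
          rw [sum_adjMat_mul_of_mem_nbrs hz] at h1
          have h2 := hinner z hz
          have h3 := hx1 u
          linarith
      _ = 2 * ∑ z ∈ nbrs G u, degIn G (nbrs G u) z +
          ∑ w ∈ far G u, (∑ z ∈ nbrs G u, degIn G (nbrs G u) z * adjMat G z w) * x w := by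
          simp only [mul_add, sum_add_distrib, mul_sum, sum_mul]
          rw [sum_comm (s := nbrs G u) (t := far G u)]
          simp only [mul_comm, mul_left_comm]
      _ ≤ _ := by
          gcongr with w hw
          exact mul_le_of_le_one_left (hx0 w) (hfar w hw)
  have hlast : ρ * ∑ w ∈ far G u, x w ≤
      ∑ z ∈ far G u, (degIn G (nbrs G u) z + degIn G (far G u) z) := by
    rw [mul_sum]
    refine sum_le_sum fun w hw => ?_
    rw [← ncDegree_of_mem_far hw, ncDegree_eq_sum]
    exact (hsub w).trans
      (sum_le_sum fun j _ => mul_le_of_le_one_right (adjMat_nonneg w j) (hx1 j))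
  have := mul_le_mul_of_nonneg_left hstep hρ
  linarith

end Counting

section Estimate

open Finset Classical

/-- The real-number inequalities behind the order estimate. -/
lemma hub_count_le {m k s ρ τ d Y XY h nh : ℝ} (hs : s ^ 2 = m) (hs1 : 864 ≤ s)
    (hτ : 123 * τ ≤ s) (hρ : s - 1 ≤ ρ) (hk : 0 ≤ k) (hh : 0 ≤ h)
    (hhub : 3 / 4 * ρ * h ≤ XY) (hXY : XY ≤ m - d + Y / 2) (hY : Y / 2 ≤ τ) (hnh : nh ≤ 4 * τ)
    (hlow : (m + k) / 2 ≤ d + h + nh) : h ≤ s - 1 - 4 * τ := by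
  have h1 : 3 / 4 * (s - 1) * h ≤ m / 2 + h + 5 * τ := by
    have : 3 / 4 * (s - 1) * h ≤ 3 / 4 * ρ * h := by gcongr
    linarith
  by_contra! hlt
  have h2 : 9 / 10 * s ≤ h := by linarith
  nlinarith

lemma deficit_le {m k s ρ d E X Y P Q : ℝ} (hs : s ^ 2 = m) (hs1 : 864 ≤ s) (hρ : s - 1 ≤ ρ)
    (hE : 0 ≤ E) (hd : 0 ≤ d) (hX : 0 ≤ X)
    (hcount : 2 * m = 2 * d + E + 2 * X + Y)
    (hrad : ρ ^ 2 ≤ d + P + Q) (htri : ρ ^ 2 * P ≤ 2 * ρ * E + (X + Y))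
    (hlarge : m - (k + 1) ≤ ρ ^ 2) : 3 * E / 8 + (X - Q) + Y / 2 ≤ k + 5 := by
  have h1 : (s - 1) ^ 2 ≤ ρ ^ 2 := by gcongr; linarith
  have h2 : m ≤ 2 * ρ ^ 2 := by nlinarith
  have h3 : 2 * ρ * E ≤ ρ ^ 2 * (E / 8) := by
    have h4 : 0 ≤ ρ * E := mul_nonneg (by linarith) hE
    have h5 : 16 * (ρ * E) ≤ ρ * (ρ * E) := by gcongr; linarith
    linarith
  have hP : P ≤ E / 8 + 4 := by
    refine le_of_mul_le_mul_left ?_ (show 0 < ρ ^ 2 by nlinarith)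
    linarith
  linarith

variable {V : Type*} [Fintype V] {G : SimpleGraph V} {u : V} {x : V → ℝ} {ρ : ℝ} {k m : ℕ}

lemma one_le_ncDegree (hconn : G.Connected) (hE : 2 ≤ G.edgeSet.ncard) (z : V) :
    1 ≤ ncDegree G z := by
  have : Nontrivial V := by
    by_contra h
    rw [not_nontrivial_iff_subsingleton] at h
    have : G.edgeSet = ∅ := by
      ext e
      induction e with | _ a b
      simp [Subsingleton.elim a b]
    simp [this] at hE
  obtain ⟨w, hw⟩ := hconn.preconnected.exists_adj_of_nontrivial z
  exact (Set.ncard_pos).2 ⟨w, hw⟩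

/-- Non-pendant neighbours of `u` carry a further edge. -/
lemma card_nbrs_le (hconn : G.Connected) (hE : 2 ≤ G.edgeSet.ncard) :
    (#(nbrs G u) : ℝ) ≤ {v : V | ncDegree G v = 1}.ncard +
      ∑ z ∈ nbrs G u, degIn G (nbrs G u) z + ∑ z ∈ far G u, degIn G (nbrs G u) z := by
  rw [← sum_degIn_comm (nbrs G u) (far G u), add_assoc, ← sum_add_distrib]
  have h1 : #{z ∈ nbrs G u | ncDegree G z = 1} ≤ {v : V | ncDegree G v = 1}.ncard := by
    rw [← Set.ncard_coe_finset]
    exact Set.ncard_le_ncard (fun z hz => (mem_filter.1 hz).2) (Set.toFinite _)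
  have h2 : (#{z ∈ nbrs G u | ¬ ncDegree G z = 1} : ℝ) ≤
      ∑ z ∈ nbrs G u, (degIn G (nbrs G u) z + degIn G (far G u) z) := by
    rw [← nsmul_one, ← sum_const, sum_filter]
    refine sum_le_sum fun z hz => ?_
    have h3 := ncDegree_of_mem_nbrs hz
    have h4 := one_le_ncDegree hconn hE z
    split_ifs with h5
    · exact add_nonneg (degIn_nonneg _ _) (degIn_nonneg _ _)
    · have : (2 : ℝ) ≤ ncDegree G z := by exact_mod_cast (by omega : 2 ≤ ncDegree G z)
      linarith
  have h3 : (#(nbrs G u) : ℝ) = #{z ∈ nbrs G u | ncDegree G z = 1} +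
      #{z ∈ nbrs G u | ¬ ncDegree G z = 1} := by
    exact_mod_cast (card_filter_add_card_filter_not _).symm
  have h4 : (#{z ∈ nbrs G u | ncDegree G z = 1} : ℝ) ≤ {v : V | ncDegree G v = 1}.ncard := by
    exact_mod_cast h1
  linarith

lemma order_bounds_of_subinvariant (hk : 2 ≤ k) (hm : (432 * k) ^ 2 ≤ m)
    (hconn : G.Connected) (hsize : G.edgeSet.ncard = m)
    (hpendant : {v : V | ncDegree G v = 1}.ncard = k - 2)
    (hcut : ∀ e ∈ G.edgeSet, e ∉ pendantEdges G →
      ∃ f ∈ G.edgeSet, f ∉ pendantEdges G ∧ f ≠ e ∧ ∃ S, IsPairCut G e f S)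
    (hρ : 0 ≤ ρ) (hx0 : ∀ i, 0 ≤ x i) (hx1 : ∀ i, x i ≤ 1) (hxu : x u = 1)
    (hsub : ∀ i, ρ * x i ≤ ∑ j, adjMat G i j * x j) (hlarge : (m : ℝ) - (k + 1) ≤ ρ ^ 2) :
    ((m : ℝ) + k) / 2 + 1 ≤ Fintype.card V ∧
      (Fintype.card V : ℝ) ≤ ((m : ℝ) + k) / 2 + √(m : ℝ) - 1 := by
  have hE : 2 ≤ G.edgeSet.ncard := by rw [hsize]; nlinarith
  obtain ⟨s, hs⟩ : ∃ s, s = √(m : ℝ) := ⟨_, rfl⟩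
  have hk' : (2 : ℝ) ≤ k := by exact_mod_cast hk
  have hs2 : s ^ 2 = m := by rw [hs]; exact Real.sq_sqrt (Nat.cast_nonneg m)
  have hsk : 432 * (k : ℝ) ≤ s := by
    rw [hs]; refine Real.le_sqrt_of_sq_le ?_; exact_mod_cast hm
  have hρs : s - 1 ≤ ρ := by
    have h : (s - 1) ^ 2 ≤ ρ ^ 2 := by nlinarith
    exact le_of_sq_le_sq h hρ
  have hcount := two_mul_ncard_edgeSet G u
  have hrad := sq_le_of_subinvariant hρ hxu hsub
  have htri := sq_mul_sum_degIn_nbrs_le (u := u) hcut hρ hx0 hx1 hsub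
  have hd := card_nbrs_le (u := u) hconn hE
  have hn := card_eq_one_add G u
  have hpend : (({v : V | ncDegree G v = 1}.ncard : ℕ) : ℝ) = k - 2 := by
    rw [hpendant]; push_cast [hk]; ring
  rw [sum_add_distrib] at htri
  rw [hpend] at hd
  rw [hsize] at hcount
  rw [← hs]
  have hE0 : 0 ≤ ∑ z ∈ nbrs G u, degIn G (nbrs G u) z := sum_nonneg fun _ _ => degIn_nonneg _ _
  have hX0 : 0 ≤ ∑ z ∈ far G u, degIn G (nbrs G u) z := sum_nonneg fun _ _ => degIn_nonneg _ _
  have hY0 : 0 ≤ ∑ z ∈ far G u, degIn G (far G u) z := sum_nonneg fun _ _ => degIn_nonneg _ _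
  have hd0 : (0 : ℝ) ≤ #(nbrs G u) := Nat.cast_nonneg _
  have hr_le : ∀ z ∈ far G u, degIn G (far G u) z ≤ ∑ z ∈ far G u, degIn G (far G u) z :=
    fun z hz => single_le_sum (f := degIn G (far G u)) (fun _ _ => degIn_nonneg _ _) hz
  have hdegfar : ∀ z ∈ far G u, 1 ≤ degIn G (nbrs G u) z + degIn G (far G u) z := fun z hz => by
    rw [← ncDegree_of_mem_far hz]; exact_mod_cast one_le_ncDegree hconn hE z
  have hhubdeg : ∀ z ∈ far G u, 3 / 4 < x z →
      3 / 4 * ρ ≤ degIn G (nbrs G u) z + degIn G (far G u) z := fun z hz hxz => by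
    rw [← ncDegree_of_mem_far hz, ncDegree_eq_sum]
    calc 3 / 4 * ρ ≤ ρ * x z := by nlinarith
      _ ≤ _ := (hsub z).trans
        (sum_le_sum fun j _ => mul_le_of_le_one_right (adjMat_nonneg z j) (hx1 j))
  have hQX : ∑ z ∈ far G u with ¬ 3 / 4 < x z, degIn G (nbrs G u) z ≤
      4 * (∑ z ∈ far G u, degIn G (nbrs G u) z - ∑ z ∈ far G u, degIn G (nbrs G u) z * x z) := by
    rw [← sum_sub_distrib, mul_sum, sum_filter]
    refine sum_le_sum fun z _ => ?_
    have h1 := degIn_nonneg (G := G) (nbrs G u) z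
    split_ifs with h2
    · have := hx1 z; nlinarith
    · push Not at h2; nlinarith
  have hcardfar : (#(far G u) : ℝ) = #{z ∈ far G u | 3 / 4 < x z} +
      #{z ∈ far G u | ¬ 3 / 4 < x z} := by
    exact_mod_cast (card_filter_add_card_filter_not _).symm
  have hXsplit := sum_filter_add_sum_filter_not (far G u) (fun z => 3 / 4 < x z)
    (degIn G (nbrs G u))
  have hYsplit := sum_filter_add_sum_filter_not (far G u) (fun z => 3 / 4 < x z)
    (degIn G (far G u))
  have hYh : 0 ≤ ∑ z ∈ far G u with 3 / 4 < x z, degIn G (far G u) z :=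
    sum_nonneg fun _ _ => degIn_nonneg _ _
  have hYnh : 0 ≤ ∑ z ∈ far G u with ¬ 3 / 4 < x z, degIn G (far G u) z :=
    sum_nonneg fun _ _ => degIn_nonneg _ _
  have hXnh : 0 ≤ ∑ z ∈ far G u with ¬ 3 / 4 < x z, degIn G (nbrs G u) z :=
    sum_nonneg fun _ _ => degIn_nonneg _ _
  have hnonhub : (#{z ∈ far G u | ¬ 3 / 4 < x z} : ℝ) ≤
      ∑ z ∈ far G u with ¬ 3 / 4 < x z, degIn G (nbrs G u) z +
        ∑ z ∈ far G u with ¬ 3 / 4 < x z, degIn G (far G u) z := by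
    rw [← sum_add_distrib, ← nsmul_one, ← sum_const]
    exact sum_le_sum fun z hz => hdegfar z (mem_filter.1 hz).1
  have hhub : 3 / 4 * ρ * #{z ∈ far G u | 3 / 4 < x z} ≤
      ∑ z ∈ far G u with 3 / 4 < x z, degIn G (nbrs G u) z +
        ∑ z ∈ far G u with 3 / 4 < x z, degIn G (far G u) z := by
    rw [← sum_add_distrib, mul_comm, ← nsmul_eq_mul, ← sum_const]
    exact sum_le_sum fun z hz => hhubdeg z (mem_filter.1 hz).1 (mem_filter.1 hz).2
  have hhubs : (∑ z ∈ far G u with 3 / 4 < x z, degIn G (nbrs G u) z ≠ 0) →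
      ∃ z ∈ far G u, 3 / 4 < x z := fun h => by
    obtain ⟨z, hz, -⟩ := exists_ne_zero_of_sum_ne_zero h
    exact ⟨z, (mem_filter.1 hz).1, (mem_filter.1 hz).2⟩
  have hh0 : (0 : ℝ) ≤ #{z ∈ far G u | 3 / 4 < x z} := Nat.cast_nonneg _
  generalize #(nbrs G u) = d at *
  generalize ∑ z ∈ nbrs G u, degIn G (nbrs G u) z = E at *
  generalize ∑ z ∈ nbrs G u, degIn G (nbrs G u) z * x z = P at *
  generalize ∑ z ∈ far G u, degIn G (nbrs G u) z = X at *
  generalize ∑ z ∈ far G u, degIn G (nbrs G u) z * x z = Q at *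
  generalize ∑ z ∈ far G u, degIn G (far G u) z = Y at *
  generalize ∑ z ∈ far G u with ¬ 3 / 4 < x z, degIn G (nbrs G u) z = Xn at *
  generalize ∑ z ∈ far G u with 3 / 4 < x z, degIn G (nbrs G u) z = Xh at *
  generalize ∑ z ∈ far G u with ¬ 3 / 4 < x z, degIn G (far G u) z = Yn at *
  generalize ∑ z ∈ far G u with 3 / 4 < x z, degIn G (far G u) z = Yh at *
  have hmain : 3 * E / 8 + (X - Q) + Y / 2 ≤ k + 5 :=
    deficit_le hs2 (by linarith) hρs hE0 hd0 hX0 hcount hrad htri hlarge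
  have hXQ : 0 ≤ X - Q := by linarith
  obtain ⟨v, hv, hxv⟩ := hhubs <| by
    intro h0
    have : 864 * s ≤ m := by rw [← hs2, sq]; nlinarith
    linarith
  have hlow : m + (k - 2) + 4 ≤ 2 * Nat.card V := by
    rw [← hsize, ← hpendant, ← ncard_pendantEdges hconn hE]
    refine ncard_edgeSet_add_le hconn hcut (mem_far.1 hv).1.symm ?_
    have h1 := hhubdeg v hv hxv
    have h2 := hr_le v hv
    have h3 : (3 : ℝ) ≤ degIn G (nbrs G u) v := by linarith
    rw [degIn_eq_card] at h3
    have h4 : 3 ≤ #{w ∈ nbrs G u | G.Adj v w} := by exact_mod_cast h3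
    rw [← Set.ncard_coe_finset] at h4
    refine h4.trans_eq ?_
    congr 1
    ext w
    simp [mem_nbrs]
  rw [Nat.card_eq_fintype_card] at hlow
  have hlow' : (m : ℝ) + (k - 2) + 4 ≤ 2 * Fintype.card V := by
    have : ((m + (k - 2) + 4 : ℕ) : ℝ) ≤ (2 * Fintype.card V : ℕ) := by exact_mod_cast hlow
    push_cast [hk] at this
    exact this
  refine ⟨by linarith, ?_⟩
  have := hub_count_le (τ := k + 5) (d := d) (Y := Y) (XY := X + Y) hs2 (by linarith)
    (by linarith) hρs (by linarith) hh0 (by linarith) (by linarith) (by linarith)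
    (nh := #{z ∈ far G u | ¬ 3 / 4 < x z}) (by linarith) (k := k) (by linarith)
  linarith

end Estimate

section Minimality

variable {V : Type*} [Finite V] {G : SimpleGraph V} {k : ℕ}

lemma ncard_incidenceSet (v : V) : (G.incidenceSet v).ncard = ncDegree G v := by
  classical
  have := Fintype.ofFinite V
  rw [ncDegree, ← Nat.card_coe_set_eq, ← Nat.card_coe_set_eq]
  exact Nat.card_congr (G.incidenceSetEquivNeighborSet v)

lemma ncard_biUnion_incidenceSet_le (D : Finset V) :
    (⋃ v ∈ D, G.incidenceSet v).ncard ≤ ∑ v ∈ D, ncDegree G v := by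
  classical
  induction D using Finset.induction_on with
  | empty => simp
  | insert a D ha ih =>
    rw [Finset.sum_insert ha, Finset.set_biUnion_insert]
    refine (Set.ncard_union_le _ _).trans ?_
    rw [ncard_incidenceSet]
    gcongr

/-- Isolating a set of low-degree vertices certifies criticality of the edges it meets. -/
lemma edgeConnL_deleteEdges_lt {D : Finset V} {u : V} {e : Sym2 V} (hu : u ∉ D)
    (hD : k ≤ D.card + 1) (hdeg : ∑ v ∈ D, ncDegree G v ≤ k)
    (he : e ∈ ⋃ v ∈ D, G.incidenceSet v) : edgeConnL k (G.deleteEdges {e}) < k := by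
  classical
  have hI : ⋃ v ∈ D, G.incidenceSet v ⊆ G.edgeSet :=
    Set.iUnion₂_subset fun v _ => G.incidenceSet_subset v
  have hcard : k ≤ (insert u (D : Set V)).ncard := by
    rwa [Set.ncard_insert_of_notMem (by simpa using hu), Set.ncard_coe_finset]
  rw [edgeConnL_lt_iff (hcard.trans (Set.ncard_le_card _))]
  refine ⟨(⋃ v ∈ D, G.incidenceSet v) \ {e}, ?_, ?_, ?_⟩
  · rw [edgeSet_deleteEdges]
    exact Set.sdiff_subset_sdiff_left hI
  · rw [deleteEdges_deleteEdges, Set.union_sdiff_self, Set.union_eq_self_of_subset_left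
      (Set.singleton_subset_iff.2 he)]
    refine hcard.trans (ncard_le_card_connectedComponent ?_)
    have hiso : ∀ a ∈ D, ∀ y, ¬ (G.deleteEdges (⋃ v ∈ D, G.incidenceSet v)).Adj a y := by
      intro a ha y h
      rw [deleteEdges_adj] at h
      exact h.2 (Set.mem_biUnion ha ⟨h.1, Sym2.mem_mk_left a y⟩)
    rintro a (rfl | ha) b (rfl | hb) hab
    · exact absurd rfl hab
    · exact fun h => not_reachable_of_isolated (hiso b hb) hab.symm h.symm
    · exact not_reachable_of_isolated (hiso a ha) hab
    · exact not_reachable_of_isolated (hiso a ha) hab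
  · have := (ncard_biUnion_incidenceSet_le (G := G) D).trans hdeg
    rw [Set.ncard_sdiff_singleton_of_mem he]
    have := (Set.ncard_pos (Set.toFinite _)).2 ⟨e, he⟩
    omega

lemma isMinimallyKLEdgeConnected_of_degrees (hk : 2 ≤ k) (hconn : G.Connected)
    (hE : 2 ≤ G.edgeSet.ncard) (hleaf : {v | ncDegree G v = 1}.ncard = k - 2)
    (hbridge : ∀ e ∈ G.edgeSet, e ∉ pendantEdges G → (G.deleteEdges {e}).Connected)
    (hlow : ∀ e ∈ G.edgeSet, ∃ y ∈ e, ncDegree G y = 1 ∨ ncDegree G y = 2)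
    {y₀ u : V} (hy₀ : ncDegree G y₀ = 2) (hu : 3 ≤ ncDegree G u) :
    IsMinimallyKLEdgeConnected k k G := by
  classical
  have := Fintype.ofFinite V
  obtain ⟨L, hL⟩ : ∃ L : Finset V, (L : Set V) = {v | ncDegree G v = 1} :=
    ⟨(Set.toFinite _).toFinset, Set.Finite.coe_toFinset _⟩
  have hmem : ∀ v, v ∈ L ↔ ncDegree G v = 1 := fun v => by
    rw [← Finset.mem_coe, hL]; rfl
  have hLcard : L.card = k - 2 := by rw [← hleaf, ← hL, Set.ncard_coe_finset]
  have hmin : ∀ y, ncDegree G y = 2 → ∀ e ∈ G.edgeSet, ∀ z ∈ insert y L, z ∈ e →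
      edgeConnL k (G.deleteEdges {e}) < k := by
    intro y hy e he z hz hze
    have hyL : y ∉ L := by rw [hmem]; omega
    refine edgeConnL_deleteEdges_lt (D := insert y L) (u := u) ?_ ?_ ?_
      (Set.mem_biUnion hz ⟨he, hze⟩)
    · rw [Finset.mem_insert, hmem]
      rintro (rfl | h) <;> omega
    · rw [Finset.card_insert_of_notMem hyL]; omega
    · rw [Finset.sum_insert hyL, Finset.sum_congr rfl fun v hv => (hmem v).1 hv]
      simp; omega
  have hV : k ≤ Nat.card V := by
    have h1 : y₀ ∉ L := by rw [hmem]; omega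
    have h2 : u ∉ insert y₀ L := by
      rw [Finset.mem_insert, hmem]
      rintro (rfl | h) <;> omega
    have h3 := Finset.card_le_univ (insert u (insert y₀ L))
    rw [Finset.card_insert_of_notMem h2, Finset.card_insert_of_notMem h1, hLcard] at h3
    rw [Nat.card_eq_fintype_card]
    omega
  refine ⟨hconn, (le_edgeConnL_iff hV).2 fun F hF hcomp => ?_, fun e he => ?_⟩
  · by_contra! hlt
    have hsub : F ⊆ pendantEdges G := fun f hf => by
      by_contra hfp
      exact not_connected_deleteEdges_of_le_card hlt hcomp hf (hbridge f (hF hf) hfp)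
    have h1 := Set.ncard_le_ncard hsub (Set.toFinite _)
    rw [ncard_pendantEdges hconn hE, hleaf] at h1
    have h2 := card_connectedComponent_deleteEdges_le G F
    rw [card_connectedComponent_eq_one hconn] at h2
    omega
  · obtain ⟨y, hye, hy | hy⟩ := hlow e he
    · exact hmin y₀ hy₀ e he y (Finset.mem_insert_of_mem ((hmem y).2 hy)) hye
    · exact hmin y hy e he y (Finset.mem_insert_self y L) hye

end Minimality

section Comparison

/-- The vertices of the comparison graph: two hubs, `t` middle vertices, `p` leaves and the
further vertices of `q` triangles. -/
abbrev ComparisonVertex (t p q : ℕ) : Type := Bool ⊕ Fin t ⊕ Fin p ⊕ Fin q × Bool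

variable {t p q : ℕ}

/-- Adjacency in the comparison graph, listed in one direction. -/
def comparisonRel : ComparisonVertex t p q → ComparisonVertex t p q → Prop
  | .inl _, .inr (.inl _) => True
  | .inl b, .inr (.inr (.inl _)) => b = false
  | .inl b, .inr (.inr (.inr _)) => b = false
  | .inr (.inr (.inr x)), .inr (.inr (.inr y)) => x.1 = y.1
  | _, _ => False

/-- The graph `K_{2,t}` with `p` pendant edges and `q` triangles attached to a vertex of
degree `t`. -/
def comparisonGraph (t p q : ℕ) : SimpleGraph (ComparisonVertex t p q) :=
  SimpleGraph.fromRel comparisonRel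

open Finset

lemma ncDegree_comparisonGraph (x : ComparisonVertex t p q) :
    (ncDegree (comparisonGraph t p q) x : ℝ) =
      ∑ b, adjMat (comparisonGraph t p q) x (.inl b) +
      (∑ i, adjMat (comparisonGraph t p q) x (.inr (.inl i)) +
      (∑ j, adjMat (comparisonGraph t p q) x (.inr (.inr (.inl j))) +
      ∑ y, adjMat (comparisonGraph t p q) x (.inr (.inr (.inr y))))) := by
  simp only [ncDegree_eq_sum, Fintype.sum_sum_type]

lemma ncDegree_hub (b : Bool) : ncDegree (comparisonGraph t p q) (.inl b) =
    t + if b then 0 else p + 2 * q := by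
  rw [← Nat.cast_inj (R := ℝ), ncDegree_comparisonGraph]
  cases b <;> simp [adjMat_apply, comparisonGraph, comparisonRel, mul_comm]

lemma ncDegree_mid (i : Fin t) : ncDegree (comparisonGraph t p q) (.inr (.inl i)) = 2 := by
  rw [← Nat.cast_inj (R := ℝ), ncDegree_comparisonGraph]
  simp [adjMat_apply, comparisonGraph, comparisonRel]

lemma ncDegree_leaf (j : Fin p) : ncDegree (comparisonGraph t p q) (.inr (.inr (.inl j))) = 1 := by
  rw [← Nat.cast_inj (R := ℝ), ncDegree_comparisonGraph]
  simp [adjMat_apply, comparisonGraph, comparisonRel]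

lemma ncDegree_triangle (x : Fin q × Bool) :
    ncDegree (comparisonGraph t p q) (.inr (.inr (.inr x))) = 2 := by
  rw [← Nat.cast_inj (R := ℝ), ncDegree_comparisonGraph]
  obtain ⟨r, c⟩ := x
  have h : ∀ s, (r = s ∨ s = r) ↔ r = s := fun s => by rw [eq_comm, or_self]
  simp only [Fintype.sum_prod_type, Fintype.sum_bool]
  cases c <;> simp [adjMat_apply, comparisonGraph, comparisonRel, h] <;> norm_num

lemma ncard_edgeSet_comparisonGraph :
    (comparisonGraph t p q).edgeSet.ncard = 2 * t + p + 3 * q := by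
  have h := sum_ncDegree (comparisonGraph t p q)
  simp only [Fintype.sum_sum_type, ncDegree_hub, ncDegree_mid, ncDegree_leaf, ncDegree_triangle]
    at h
  have h' : ((2 * (comparisonGraph t p q).edgeSet.ncard : ℕ) : ℝ) =
      (2 * (2 * t + p + 3 * q) : ℕ) := by
    push_cast
    rw [← h]
    simp
    ring
  have := Nat.cast_injective h'
  omega

lemma connected_comparisonGraph (ht : 3 ≤ t) : (comparisonGraph t p q).Connected := by
  have hadj : ∀ x y, (comparisonGraph t p q).Adj x y → (comparisonGraph t p q).Reachable x y :=
    fun x y h => h.reachable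
  have h : ∀ x, (comparisonGraph t p q).Reachable x (.inl false) := by
    have hmid : ∀ i, (comparisonGraph t p q).Reachable (.inr (.inl i)) (.inl false) :=
      fun i => hadj _ _ (by simp [comparisonGraph, comparisonRel])
    rintro ((_ | _) | i | j | x)
    · exact .rfl
    · exact (hadj _ (.inr (.inl ⟨0, by omega⟩)) (by simp [comparisonGraph, comparisonRel])).trans
        (hmid _)
    · exact hmid i
    · exact hadj _ _ (by simp [comparisonGraph, comparisonRel])
    · exact hadj _ _ (by simp [comparisonGraph, comparisonRel])
  have : Nonempty (ComparisonVertex t p q) := ⟨.inl false⟩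
  exact ⟨fun x y => (h x).trans (h y).symm⟩

lemma sq_specRad_comparisonGraph (ht : 3 ≤ t) :
    0 ≤ specRad (comparisonGraph t p q) ∧ 2 * (t : ℝ) ≤ specRad (comparisonGraph t p q) ^ 2 := by
  have ht0 : (0 : ℝ) < t := by exact_mod_cast (by omega : 0 < t)
  have ha : √((t : ℝ) / 2) ^ 2 = t / 2 := Real.sq_sqrt (by positivity)
  have ha0 := Real.sqrt_nonneg ((t : ℝ) / 2)
  generalize √((t : ℝ) / 2) = a at ha ha0
  obtain ⟨ρ, hρ⟩ : ∃ ρ, ρ = specRad (comparisonGraph t p q) := ⟨_, rfl⟩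
  have h := rayleigh_le_specRad (comparisonGraph t p q)
    (Sum.elim (fun _ => a) (Sum.elim (fun _ => 1) 0))
  rw [← hρ] at h ⊢
  simp only [dotProduct, Matrix.mulVec, Fintype.sum_sum_type, adjMat_apply] at h
  simp [comparisonGraph, comparisonRel] at h
  have h1 : 2 * a ≤ ρ := by
    refine le_of_mul_le_mul_right ?_ (show (0 : ℝ) < 2 * t by positivity)
    rw [← sq, ha] at h
    linarith
  exact ⟨by linarith, by nlinarith⟩

lemma reachable_of_comparisonRel (ht : 3 ≤ t) {x y : ComparisonVertex t p q}
    (hne : x ≠ y) (hxy : comparisonRel x y)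
    (hp : s(x, y) ∉ pendantEdges (comparisonGraph t p q)) :
    ((comparisonGraph t p q).deleteEdges {s(x, y)}).Reachable x y := by
  have hadj : (comparisonGraph t p q).Adj x y := (fromRel_adj _ _ _).2 ⟨hne, .inl hxy⟩
  have step : ∀ a b, ((comparisonGraph t p q).deleteEdges {s(x, y)}).Adj a b →
      ((comparisonGraph t p q).deleteEdges {s(x, y)}).Reachable a b := fun _ _ h => h.reachable
  match x, y, hxy with
  | .inl b, .inr (.inl i), _ =>
    obtain ⟨j, hj⟩ : ∃ j : Fin t, j ≠ i := by
      have : Nontrivial (Fin t) := Fin.nontrivial_iff_two_le.2 (by omega)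
      exact exists_ne i
    exact (step _ (.inr (.inl j)) (by simp [comparisonGraph, comparisonRel, hj])).trans
      ((step _ (.inl !b) (by simp [comparisonGraph, comparisonRel])).trans
        (step _ _ (by simp [comparisonGraph, comparisonRel])))
  | .inl b, .inr (.inr (.inl j)), _ =>
    exact absurd ⟨hadj, _, Sym2.mem_mk_right _ _, ncDegree_leaf j⟩ hp
  | .inl b, .inr (.inr (.inr (r, c))), h =>
    obtain rfl : b = false := h
    exact (step _ (.inr (.inr (.inr (r, !c)))) (by simp [comparisonGraph, comparisonRel])).trans
        (step _ _ (by simp [comparisonGraph, comparisonRel]))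
  | .inr (.inr (.inr x)), .inr (.inr (.inr y)), h =>
    exact (step _ (.inl false) (by simp [comparisonGraph, comparisonRel])).trans
        (step _ _ (by simp [comparisonGraph, comparisonRel]))

lemma connected_deleteEdges_comparisonGraph (ht : 3 ≤ t) {e : Sym2 (ComparisonVertex t p q)}
    (he : e ∈ (comparisonGraph t p q).edgeSet) (hp : e ∉ pendantEdges (comparisonGraph t p q)) :
    ((comparisonGraph t p q).deleteEdges {e}).Connected := by
  induction e with | _ x y
  refine (connected_comparisonGraph ht).connected_delete_edge_of_not_isBridge fun hb => ?_
  rw [isBridge_iff] at hb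
  obtain ⟨hne, h | h⟩ := (fromRel_adj _ _ _).1 he
  · exact hb (reachable_of_comparisonRel ht hne h hp)
  · rw [Sym2.eq_swap] at hb hp
    exact hb (reachable_of_comparisonRel ht hne.symm h hp).symm

lemma isMinimallyKLEdgeConnected_comparisonGraph (ht : 3 ≤ t) :
    IsMinimallyKLEdgeConnected (p + 2) (p + 2) (comparisonGraph t p q) := by
  refine isMinimallyKLEdgeConnected_of_degrees (by omega) (connected_comparisonGraph ht) ?_ ?_
    (fun e => connected_deleteEdges_comparisonGraph ht) ?_ (y₀ := .inr (.inl ⟨0, by omega⟩))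
    (u := .inl true) (ncDegree_mid _) (by simpa [ncDegree_hub] using ht)
  · rw [ncard_edgeSet_comparisonGraph]; omega
  · have : {v | ncDegree (comparisonGraph t p q) v = 1} =
        Set.range fun j : Fin p => (.inr (.inr (.inl j)) : ComparisonVertex t p q) := by
      ext v
      rcases v with (_ | _) | i | j | x <;>
        simp [ncDegree_hub, ncDegree_mid, ncDegree_leaf, ncDegree_triangle] <;> omega
    rw [this, ← Set.image_univ, Set.ncard_image_of_injective _ fun _ _ h => by simpa using h]
    simp
  · have hrel : ∀ x y : ComparisonVertex t p q, comparisonRel x y →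
        ncDegree (comparisonGraph t p q) y = 1 ∨ ncDegree (comparisonGraph t p q) y = 2 := by
      intro x y h
      match x, y, h with
      | .inl _, .inr (.inl i), _ => exact .inr (ncDegree_mid i)
      | .inl _, .inr (.inr (.inl j)), _ => exact .inl (ncDegree_leaf j)
      | .inl _, .inr (.inr (.inr x)), _ => exact .inr (ncDegree_triangle x)
      | .inr (.inr (.inr _)), .inr (.inr (.inr x)), _ => exact .inr (ncDegree_triangle x)
    intro e he
    induction e with | _ x y
    obtain ⟨-, h | h⟩ := (fromRel_adj _ _ _).1 he
    · exact ⟨y, Sym2.mem_mk_right x y, hrel x y h⟩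
    · exact ⟨x, Sym2.mem_mk_left x y, hrel y x h⟩

/-- The comparison graphs give a lower bound for the maximal spectral radius. -/
lemma exists_large_specRad {k m : ℕ} (hk : 2 ≤ k) (hm : k + 10 ≤ m) :
    ∃ t q : ℕ, IsMinimallyKLEdgeConnected k k (comparisonGraph t (k - 2) q) ∧
      (comparisonGraph t (k - 2) q).edgeSet.ncard = m ∧
      0 ≤ specRad (comparisonGraph t (k - 2) q) ∧
      (m : ℝ) - (k + 1) ≤ specRad (comparisonGraph t (k - 2) q) ^ 2 := by
  obtain ⟨p, rfl⟩ := Nat.exists_eq_add_of_le' hk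
  obtain ⟨t, q, ht, hq, hm⟩ : ∃ t q, 3 ≤ t ∧ q ≤ 1 ∧ m = 2 * t + p + 3 * q :=
    ⟨(m - p - 3 * ((m - p) % 2)) / 2, (m - p) % 2, by omega, by omega, by omega⟩
  refine ⟨t, q, ?_, ?_, ?_⟩
  · exact isMinimallyKLEdgeConnected_comparisonGraph ht
  · rw [ncard_edgeSet_comparisonGraph, hm]; rfl
  · have h := sq_specRad_comparisonGraph (p := p + 2 - 2) (q := q) ht
    have hq' : (q : ℝ) ≤ 1 := by exact_mod_cast hq
    refine ⟨h.1, le_trans ?_ h.2⟩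
    rw [hm]
    push_cast
    linarith

end Comparison

/-- Let `k ≥ 2` and `m ≥ (432k)²`, and let `G` be a graph attaining the maximum spectral
radius among all minimally `(k,k)`-edge-connected graphs with `m` edges.  If `G` has
exactly `k − 2` vertices of degree 1, then the number of vertices of `G` satisfies
`(m+k)/2 + 1 ≤ |V(G)| ≤ (m+k)/2 + √m − 1`. -/
theorem order_bounds_of_size_extremal_graph (k m : ℕ) (hk : 2 ≤ k)
    (hm : (432 * k) ^ 2 ≤ m)
    {V : Type} [Fintype V] [DecidableEq V] (G : SimpleGraph V)
    (hG : IsMinimallyKLEdgeConnected k k G) (hsize : G.edgeSet.ncard = m)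
    (hmax : ∀ (W : Type) [Fintype W] [DecidableEq W] (H : SimpleGraph W),
      IsMinimallyKLEdgeConnected k k H → H.edgeSet.ncard = m → specRad H ≤ specRad G)
    (hpendant : {v : V | ncDegree G v = 1}.ncard = k - 2) :
    ((m : ℝ) + (k : ℝ)) / 2 + 1 ≤ (Fintype.card V : ℝ) ∧
    (Fintype.card V : ℝ) ≤ ((m : ℝ) + (k : ℝ)) / 2 + Real.sqrt (m : ℝ) - 1 := by
  have hE : 2 ≤ G.edgeSet.ncard := by rw [hsize]; nlinarith
  have := hG.1.nonempty
  obtain ⟨x, u, hx0, hx1, hxu, hsub⟩ := exists_subinvariant G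
  obtain ⟨t, q, hH, hHm, hH0, hHρ⟩ := exists_large_specRad (m := m) hk (by nlinarith)
  have hle := hmax _ _ hH hHm
  refine order_bounds_of_subinvariant hk hm hG.1 hsize hpendant
    (fun e he hep => exists_isPairCut hk hG hE hpendant he hep) (hH0.trans hle) hx0 hx1 hxu
    (fun i => ?_) (hHρ.trans (by gcongr))
  refine (hsub i).trans_eq ?_
  rw [← adjMat_mulVec_apply]
  rfl
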